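/- There exists a constant C > 0 (depending only on the distribution of ξ) such that for all integers k ≥ 1 and n ≥ 1 (with P(|𝒯| = n) > 0), the expected number of unordered pairs of vertices at graph distance k in the conditioned Galton–Watson tree satisfies E P_k(T_n) ≤ C n k. -/

import Mathlib

open scoped ENNReal BigOperators
open Set Filter

/-- Plane (ordered rooted) trees. -/
inductive PlaneTree : Type
  | node : List PlaneTree → PlaneTree

namespace PlaneTree

/-- The list of subtrees hanging off the root. -/
def children : PlaneTree → List PlaneTree
  | .node ts => ts

/-- The subtree rooted at a given position (sequence of child indices), if it exists. -/
def subtreeAt : PlaneTree → List ℕ → Option PlaneTree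
  | t, [] => some t
  | .node ts, i :: q =>
    match ts[i]? with
    | some t' => subtreeAt t' q
    | none => none

/-- The vertex set of a tree, with vertices identified with their positions. -/
def vertexSet (t : PlaneTree) : Set (List ℕ) := {q | (subtreeAt t q).isSome}

/-- The number of vertices of a tree. -/
noncomputable def size (t : PlaneTree) : ℕ := (vertexSet t).ncard

/-- The number of children of the vertex at position `q`. -/
def childCount (t : PlaneTree) (q : List ℕ) : ℕ :=
  ((subtreeAt t q).map fun t' => t'.children.length).getD 0

end PlaneTree

/-- Longest common prefix of two positions; this is the position of the last common
ancestor of the two vertices. -/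
def lca : List ℕ → List ℕ → List ℕ
  | a :: as, b :: bs => if a = b then a :: lca as bs else []
  | _, _ => []

/-- The distance from `v` up to the last common ancestor of `v` and `w`. -/
def dUp (v w : List ℕ) : ℕ := v.length - (lca v w).length

/-- The graph distance between the vertices at positions `v` and `w`. -/
def treeDist (v w : List ℕ) : ℕ := dUp v w + dUp w v

/-- The Galton–Watson probability of a given finite tree: the product, over all vertices,
of the probability that the offspring distribution takes the value given by the number of
children of the vertex. -/
noncomputable def gwProb (p : ℕ → ℝ≥0∞) (t : PlaneTree) : ℝ≥0∞ :=
  ∏ᶠ v ∈ PlaneTree.vertexSet t, p (PlaneTree.childCount t v)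

/-- `P(|𝒯| = n)` for the Galton–Watson tree `𝒯`. -/
noncomputable def probSize (p : ℕ → ℝ≥0∞) (n : ℕ) : ℝ≥0∞ :=
  ∑' t : PlaneTree, if PlaneTree.size t = n then gwProb p t else 0

/-- `E f(T_n)` where `T_n` is the Galton–Watson tree conditioned to have `n` vertices. -/
noncomputable def condExp (p : ℕ → ℝ≥0∞) (n : ℕ) (f : PlaneTree → ℝ≥0∞) : ℝ≥0∞ :=
  (∑' t : PlaneTree, if PlaneTree.size t = n then gwProb p t * f t else 0) / probSize p n

/-- The variance of the offspring distribution `p` (which has mean `1`). -/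
noncomputable def xiVar (p : ℕ → ℝ≥0∞) : ℝ≥0∞ :=
  ∑' k : ℕ, p k * ENNReal.ofReal (((k : ℝ) - 1) ^ 2)

/-- `P_k(t)`: the number of unordered pairs of vertices of `t` at graph distance `k`. -/
noncomputable def pairCount (t : PlaneTree) (k : ℕ) : ℕ :=
  {s : Set (List ℕ) | ∃ v w, v ∈ PlaneTree.vertexSet t ∧ w ∈ PlaneTree.vertexSet t ∧
    s = {v, w} ∧ treeDist v w = k}.ncard

open PowerSeries

/-! ### Weighted generating functions -/

/-- The generating function of a weighted family, graded by `s`. -/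
noncomputable def weightGF {α : Type*} (s : α → ℕ) (w : α → ℝ≥0∞) : PowerSeries ℝ≥0∞ :=
  PowerSeries.mk fun n => ∑' a, if s a = n then w a else 0

lemma coeff_weightGF {α : Type*} (s : α → ℕ) (w : α → ℝ≥0∞) (n : ℕ) :
    coeff n (weightGF s w) = ∑' a, if s a = n then w a else 0 := by
  simp [weightGF]

lemma weightGF_add {α : Type*} (s : α → ℕ) (w w' : α → ℝ≥0∞) :
    weightGF s (fun a => w a + w' a) = weightGF s w + weightGF s w' := by
  ext n
  rw [map_add]
  simp only [coeff_weightGF]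
  rw [← ENNReal.tsum_add]
  congr 1 with a
  split_ifs <;> simp

lemma weightGF_sum {α ι : Type*} (s : α → ℕ) (I : Finset ι) (w : ι → α → ℝ≥0∞) :
    weightGF s (fun a => ∑ i ∈ I, w i a) = ∑ i ∈ I, weightGF s (w i) := by
  classical
  induction I using Finset.induction_on with
  | empty => ext n; simp [coeff_weightGF]
  | insert i I hi ih => simp only [Finset.sum_insert hi, weightGF_add, ih]

lemma weightGF_equiv {α β : Type*} (e : α ≃ β) (s : β → ℕ) (w : β → ℝ≥0∞) :
    weightGF (fun a => s (e a)) (fun a => w (e a)) = weightGF s w := by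
  ext n
  simp only [coeff_weightGF]
  exact e.tsum_eq (fun b => if s b = n then w b else 0)

lemma weightGF_prod {α β : Type*} (s : α → ℕ) (s' : β → ℕ) (w : α → ℝ≥0∞) (w' : β → ℝ≥0∞) :
    weightGF (fun x : α × β => s x.1 + s' x.2) (fun x => w x.1 * w' x.2) =
      weightGF s w * weightGF s' w' := by
  ext n
  simp only [coeff_mul, coeff_weightGF]
  rw [ENNReal.tsum_prod']
  simp only [← ENNReal.tsum_mul_right]
  simp only [← ENNReal.tsum_mul_left]
  rw [← Summable.tsum_finsetSum fun _ _ => ENNReal.summable]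
  congr 1 with a
  rw [← Summable.tsum_finsetSum fun _ _ => ENNReal.summable]
  congr 1 with b
  by_cases h : s a + s' b = n
  · rw [if_pos h, Finset.sum_eq_single (s a, s' b)]
    · simp
    · rintro ⟨i, j⟩ _ hne
      simp only [ite_mul, mul_ite, zero_mul, mul_zero]
      split_ifs <;> simp_all
    · simp [h]
  · rw [if_neg h, Finset.sum_eq_zero]
    rintro ⟨i, j⟩ hij
    rw [Finset.HasAntidiagonal.mem_antidiagonal] at hij
    simp only [ite_mul, mul_ite, zero_mul, mul_zero]
    split_ifs <;> simp_all

lemma weightGF_succ {α : Type*} (s : α → ℕ) (w : α → ℝ≥0∞) :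
    weightGF (fun a => s a + 1) w = X * weightGF s w := by
  ext n
  cases n with
  | zero => simp [coeff_weightGF]
  | succ n => simp [coeff_succ_X_mul, coeff_weightGF]

/-! ### Infinite linear combinations of power series -/

/-- The power series `∑ d, c d * F d`, with coefficientwise summation. -/
noncomputable def lcomb (c : ℕ → ℝ≥0∞) (F : ℕ → PowerSeries ℝ≥0∞) : PowerSeries ℝ≥0∞ :=
  PowerSeries.mk fun n => ∑' d, c d * coeff n (F d)

lemma coeff_lcomb (c : ℕ → ℝ≥0∞) (F : ℕ → PowerSeries ℝ≥0∞) (n : ℕ) :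
    coeff n (lcomb c F) = ∑' d, c d * coeff n (F d) := by
  simp [lcomb]

lemma mul_lcomb (A : PowerSeries ℝ≥0∞) (c : ℕ → ℝ≥0∞) (F : ℕ → PowerSeries ℝ≥0∞) :
    A * lcomb c F = lcomb c fun d => A * F d := by
  ext n
  simp only [coeff_mul, coeff_lcomb, ← ENNReal.tsum_mul_left, Finset.mul_sum]
  rw [← Summable.tsum_finsetSum fun _ _ => ENNReal.summable]
  congr 1 with d
  refine Finset.sum_congr rfl fun x _ => ?_
  ring

lemma lcomb_mul (A : PowerSeries ℝ≥0∞) (c : ℕ → ℝ≥0∞) (F : ℕ → PowerSeries ℝ≥0∞) :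
    lcomb c F * A = lcomb c fun d => F d * A := by
  rw [mul_comm, mul_lcomb]
  simp only [mul_comm]

/-- A solution of the renewal equation `B = F + X * K * B` is unique. -/
lemma renewal_unique {K F B B' : PowerSeries ℝ≥0∞} (h : B = F + X * K * B)
    (h' : B' = F + X * K * B') : B = B' := by
  have key : ∀ n, ∀ m ≤ n, coeff m B = coeff m B' := by
    intro n
    induction n with
    | zero =>
      intro m hm
      obtain rfl : m = 0 := by omega
      rw [h, h']
      simp [mul_assoc]
    | succ n ih =>
      intro m hm
      rcases Nat.eq_zero_or_pos m with rfl | hpos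
      · exact ih 0 (by omega)
      obtain ⟨m, rfl⟩ : ∃ l, m = l + 1 := ⟨m - 1, by omega⟩
      rw [h, h', map_add, map_add, mul_assoc, mul_assoc, coeff_succ_X_mul, coeff_succ_X_mul,
        coeff_mul, coeff_mul]
      congr 1
      refine Finset.sum_congr rfl fun x hx => ?_
      rw [Finset.HasAntidiagonal.mem_antidiagonal] at hx
      rw [ih x.2 (by omega)]
  ext n
  exact key n n le_rfl

/-! ### The random walk and its first passage decomposition -/

/-- `P(S_M = M - N)` for the random walk `S` with step law `p`. -/
noncomputable def walkGF (p : ℕ → ℝ≥0∞) (N : ℕ) : PowerSeries ℝ≥0∞ :=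
  PowerSeries.mk fun M => if N ≤ M then coeff (M - N) ((PowerSeries.mk p) ^ M) else 0

lemma coeff_walkGF (p : ℕ → ℝ≥0∞) (N M : ℕ) :
    coeff M (walkGF p N) = if N ≤ M then coeff (M - N) ((PowerSeries.mk p) ^ M) else 0 := by
  simp [walkGF]

/-- Sums over a full antidiagonal as an unrestricted series. -/
lemma sum_antidiagonal_eq_tsum (f g : ℕ → ℝ≥0∞) (n : ℕ) :
    ∑ x ∈ Finset.HasAntidiagonal.antidiagonal n, f x.1 * g x.2 =
      ∑' d, f d * (if d ≤ n then g (n - d) else 0) := by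
  rw [Finset.Nat.sum_antidiagonal_eq_sum_range_succ (fun a b => f a * g b) n,
    tsum_eq_sum (s := Finset.range n.succ)]
  · refine Finset.sum_congr rfl fun d hd => ?_
    rw [if_pos (by simpa [Nat.lt_succ_iff] using hd)]
  · intro d hd
    rw [if_neg (by simpa [Nat.lt_succ_iff] using hd), mul_zero]

/-- One step of the walk: for `N ≥ 1`, `U_N = X * ∑ d, p d * U_(N - 1 + d)`. -/
lemma walkGF_succ (p : ℕ → ℝ≥0∞) (N : ℕ) :
    walkGF p (N + 1) = X * lcomb p fun d => walkGF p (N + d) := by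
  ext M
  cases M with
  | zero => simp [coeff_walkGF]
  | succ M =>
    rw [coeff_succ_X_mul, coeff_lcomb, coeff_walkGF]
    simp only [coeff_walkGF, Nat.add_le_add_iff_right, Nat.add_sub_add_right]
    split_ifs with h
    · rw [pow_succ', coeff_mul]
      simp only [coeff_mk]
      rw [sum_antidiagonal_eq_tsum p (fun j => coeff j (PowerSeries.mk p ^ M)) (M - N)]
      congr 1 with d
      congr 1
      rw [Nat.sub_sub]
      refine if_congr (by omega) rfl rfl
    · symm
      rw [ENNReal.tsum_eq_zero]
      intro d
      rw [if_neg (by omega), mul_zero]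

/-- The exchangeability identity `(n + 1) E[ξ₁; S_(n+1) = j] = j P(S_(n+1) = j)`. -/
lemma coeff_size_biased (p : ℕ → ℝ≥0∞) (n j : ℕ) :
    (n + 1 : ℝ≥0∞) * coeff j (PowerSeries.mk (fun d => (d : ℝ≥0∞) * p d) * PowerSeries.mk p ^ n) =
      j * coeff j (PowerSeries.mk p ^ (n + 1)) := by
  have hX : PowerSeries.mk (fun d => (d : ℝ≥0∞) * p d) = X * d⁄dX ℝ≥0∞ (PowerSeries.mk p) := by
    ext d
    cases d with
    | zero => simp
    | succ d => rw [coeff_succ_X_mul, coeff_derivative]; simp [mul_comm]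
  have hj : ∀ F : PowerSeries ℝ≥0∞, coeff j (X * d⁄dX ℝ≥0∞ F) = j * coeff j F := by
    intro F
    cases j with
    | zero => simp
    | succ d => rw [coeff_succ_X_mul, coeff_derivative]; simp [mul_comm]
  rw [hX, ← hj, derivative_pow]
  have : ((n + 1 : ℕ) : PowerSeries ℝ≥0∞) = C (n + 1 : ℝ≥0∞) := by simp
  rw [this, ← coeff_C_mul]
  congr 1
  simp
  ring

/-- The renewal equation for the walk returning to its starting level. -/
lemma walkGF_zero (p : ℕ → ℝ≥0∞) :
    walkGF p 0 = 1 + X * lcomb (fun d => (d : ℝ≥0∞) * p d) fun d => walkGF p (d - 1) := by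
  ext M
  cases M with
  | zero => simp [coeff_walkGF]
  | succ M =>
    rw [map_add, coeff_succ_X_mul, coeff_lcomb, coeff_walkGF]
    have h1 : (M + 1 : ℝ≥0∞) ≠ 0 := by simp
    have h2 : (M + 1 : ℝ≥0∞) ≠ ⊤ := by finiteness
    have := coeff_size_biased p M (M + 1)
    push_cast at this
    rw [ENNReal.mul_right_inj h1 h2] at this
    simp only [zero_le, if_true, Nat.sub_zero]
    rw [← this, coeff_mul]
    simp only [coeff_mk]
    rw [sum_antidiagonal_eq_tsum (fun d => (d : ℝ≥0∞) * p d)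
      (fun j => coeff j (PowerSeries.mk p ^ M)) (M + 1)]
    simp only [coeff_one, Nat.add_eq_zero_iff, one_ne_zero, and_false, if_false, zero_add]
    congr 1 with d
    rcases Nat.eq_zero_or_pos d with rfl | hd
    · simp
    congr 1
    rw [coeff_walkGF]
    rw [show M + 1 - d = M - (d - 1) by omega]
    refine if_congr (by omega) rfl rfl

/-- First passage decomposition: if `T = X * ∑ d, p d * T ^ d`, then `U_0 * T ^ N = U_N`. -/
lemma walkGF_zero_mul_pow {p : ℕ → ℝ≥0∞} {T : PowerSeries ℝ≥0∞}
    (hT : T = X * lcomb p fun d => T ^ d) (N : ℕ) :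
    walkGF p 0 * T ^ N = walkGF p N := by
  ext M
  induction M generalizing N with
  | zero =>
    cases N with
    | zero => simp
    | succ N =>
      rw [pow_succ, hT]
      simp [coeff_walkGF]
  | succ M ih =>
    cases N with
    | zero => simp
    | succ N =>
      have : walkGF p 0 * T ^ (N + 1) = X * lcomb p fun d => walkGF p 0 * T ^ (N + d) := by
        rw [pow_succ]
        nth_rw 2 [hT]
        rw [show ∀ a b c : PowerSeries ℝ≥0∞, a * (b * (X * c)) = X * ((a * b) * c) by
          intros; ring, mul_lcomb]
        simp only [pow_add, mul_assoc]
      rw [this, walkGF_succ, coeff_succ_X_mul, coeff_succ_X_mul, coeff_lcomb, coeff_lcomb]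
      simp only [ih]

/-- The series `U_0` inverts `1 - X * G'(T)`. -/
lemma eq_walkGF_mul_of_renewal {p : ℕ → ℝ≥0∞} {T B F : PowerSeries ℝ≥0∞}
    (hT : T = X * lcomb p fun d => T ^ d)
    (hB : B = F + X * lcomb (fun d => (d : ℝ≥0∞) * p d) (fun d => T ^ (d - 1)) * B) :
    B = walkGF p 0 * F := by
  refine renewal_unique hB ?_
  have h : walkGF p 0 =
      1 + X * lcomb (fun d => (d : ℝ≥0∞) * p d) (fun d => T ^ (d - 1)) * walkGF p 0 := by
    conv_lhs => rw [walkGF_zero]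
    rw [mul_assoc, lcomb_mul]
    congr 3 with d : 1
    rw [mul_comm, walkGF_zero_mul_pow hT]
  conv_lhs => rw [h]
  ring

/-! ### Vertices of plane trees -/

namespace PlaneTree

lemma induction_children {motive : PlaneTree → Prop}
    (h : ∀ l : List PlaneTree, (∀ t ∈ l, motive t) → motive (.node l)) (t : PlaneTree) :
    motive t := by
  match t with
  | .node l => exact h l fun t' _ => induction_children h t'
termination_by t
decreasing_by
  have := List.sizeOf_lt_of_mem ‹t' ∈ l›
  simp only [PlaneTree.node.sizeOf_spec]
  omega

/-- A plane tree is the list of its root branches. -/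
def equivList : List PlaneTree ≃ PlaneTree where
  toFun := .node
  invFun := children
  left_inv _ := rfl
  right_inv t := by cases t; rfl

lemma subtreeAt_nil (t : PlaneTree) : t.subtreeAt [] = some t := by
  cases t; simp [subtreeAt]

lemma subtreeAt_cons (l : List PlaneTree) (i : ℕ) (q : List ℕ) :
    (node l).subtreeAt (i :: q) = (l[i]?).bind fun t => t.subtreeAt q := by
  rw [subtreeAt]
  cases l[i]? <;> rfl

/-- The indicator of the vertex set of `t`. -/
def mark (t : PlaneTree) (v : List ℕ) : ℝ≥0∞ := if (t.subtreeAt v).isSome then 1 else 0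

lemma mark_nil (t : PlaneTree) : t.mark [] = 1 := by simp [mark, subtreeAt_nil]

lemma mark_cons (l : List PlaneTree) (i : ℕ) (q : List ℕ) :
    (node l).mark (i :: q) = (l[i]?).elim 0 fun t => t.mark q := by
  rw [mark, subtreeAt_cons]
  cases l[i]? <;> simp [mark]

lemma vertexSet_node (l : List PlaneTree) :
    vertexSet (node l) =
      insert [] (⋃ i : Fin l.length, (List.cons (i : ℕ)) '' vertexSet (l.get i)) := by
  ext q
  cases q with
  | nil => simp [vertexSet, subtreeAt_nil]
  | cons i q =>
    simp only [vertexSet, mem_ofPred_eq, subtreeAt_cons, mem_insert_iff, mem_iUnion, mem_image,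
      List.cons.injEq, reduceCtorEq, false_or]
    constructor
    · intro h
      by_cases hi : i < l.length
      · refine ⟨⟨i, hi⟩, q, ?_, rfl, rfl⟩
        simpa [hi] using h
      · simp [List.getElem?_eq_none (not_lt.1 hi)] at h
    · rintro ⟨⟨j, hj⟩, q', h, rfl, rfl⟩
      simpa [hj] using h

lemma vertexSet_finite (t : PlaneTree) : (vertexSet t).Finite := by
  induction t using induction_children with
  | h l ih =>
    rw [vertexSet_node]
    exact (finite_iUnion fun i => (ih _ (List.get_mem l i)).image _).insert _

end PlaneTree

open PlaneTree

lemma gwProb_node (p : ℕ → ℝ≥0∞) (l : List PlaneTree) :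
    gwProb p (.node l) = p l.length * (l.map (gwProb p)).prod := by
  have hfin : ∀ i : Fin l.length, ((List.cons (i : ℕ)) '' vertexSet (l.get i)).Finite :=
    fun i => (vertexSet_finite _).image _
  have hdisj : Pairwise (Function.onFun Disjoint
      fun i : Fin l.length => (List.cons (i : ℕ)) '' vertexSet (l.get i)) := by
    intro i j hij
    rw [Function.onFun, Set.disjoint_left]
    rintro _ ⟨q, _, rfl⟩ ⟨q', _, h⟩
    exact hij (Fin.ext (List.cons.inj h).1.symm)
  rw [gwProb, vertexSet_node, finprod_mem_insert _ (by simp) (finite_iUnion hfin),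
    finprod_mem_iUnion hdisj hfin, finprod_eq_prod_of_fintype]
  have hroot : childCount (.node l) [] = l.length := by
    simp [childCount, subtreeAt_nil, children]
  have hmap : l.map (gwProb p) = List.ofFn fun i => gwProb p (l.get i) := by
    conv_lhs => rw [← List.ofFn_get l, List.map_ofFn]
    rfl
  rw [hroot, hmap, List.prod_ofFn]
  congr 1
  refine Finset.prod_congr rfl fun i _ => ?_
  rw [finprod_mem_image (List.cons_injective.injOn), gwProb]
  refine finprod_congr fun q => ?_
  have : childCount (.node l) ((i : ℕ) :: q) = childCount (l.get i) q := by
    simp [childCount, subtreeAt_cons]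
  rw [this]

/-! ### Sums over words and over lists -/

lemma tsum_list {α : Type*} (f : List α → ℝ≥0∞) :
    ∑' l, f l = f [] + ∑' a, ∑' l, f (a :: l) := by
  classical
  have hinj : Function.Injective fun x : α × List α => x.1 :: x.2 := by
    rintro ⟨a, l⟩ ⟨b, l'⟩ h
    simpa using h
  have hsupp : Function.support (fun l => if l = [] then 0 else f l) ⊆
      range fun x : α × List α => x.1 :: x.2 := by
    intro l hl
    cases l with
    | nil => simp at hl
    | cons a l => exact ⟨(a, l), rfl⟩
  rw [ENNReal.tsum_eq_add_tsum_ite []]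
  congr 1
  refine (tsum_congr fun l => ?_).trans ((hinj.tsum_eq hsupp).symm.trans ?_)
  · congr
  · rw [ENNReal.tsum_prod']
    simp

lemma tsum_getElem?_elim {α : Type*} (g : α → ℝ≥0∞) (l : List α) :
    ∑' i : ℕ, (l[i]?).elim 0 g = (l.map g).sum := by
  induction l with
  | nil => simp
  | cons a l ih =>
    rw [tsum_eq_zero_add' ENNReal.summable]
    simp [ih]

/-- The sum of `g a b` over pairs of entries of a list at distinct positions. -/
def pairSum {α : Type*} (g : α → α → ℝ≥0∞) : List α → ℝ≥0∞
  | [] => 0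
  | a :: l => (l.map (g a)).sum + (l.map fun b => g b a).sum + pairSum g l

lemma tsum_ne_getElem?_elim {α : Type*} (g : α → α → ℝ≥0∞) (l : List α) :
    ∑' i : ℕ, ∑' j : ℕ,
      (if i = j then 0 else (l[i]?).elim 0 fun a => (l[j]?).elim 0 fun b => g a b) =
      pairSum g l := by
  induction l with
  | nil => simp [pairSum]
  | cons a l ih =>
    rw [tsum_eq_zero_add' ENNReal.summable]
    have : ∀ i : ℕ, (∑' j : ℕ, (if i + 1 = j then 0 else
          ((a :: l)[i + 1]?).elim 0 fun x => ((a :: l)[j]?).elim 0 fun b => g x b)) =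
        (l[i]?).elim 0 (fun x => g x a) + ∑' j : ℕ, (if i = j then 0 else
          (l[i]?).elim 0 fun x => (l[j]?).elim 0 fun b => g x b) := by
      intro i
      rw [tsum_eq_zero_add' ENNReal.summable]
      simp
    simp_rw [this]
    rw [ENNReal.tsum_add, ih, tsum_getElem?_elim, tsum_eq_zero_add' ENNReal.summable]
    simp [tsum_getElem?_elim, pairSum, add_assoc]

lemma pairSum_sum {α ι : Type*} (I : Finset ι) (g : ι → α → α → ℝ≥0∞) (l : List α) :
    pairSum (fun a b => ∑ i ∈ I, g i a b) l = ∑ i ∈ I, pairSum (g i) l := by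
  have hsum : ∀ (f : ι → α → ℝ≥0∞) (l : List α),
      (l.map fun a => ∑ i ∈ I, f i a).sum = ∑ i ∈ I, (l.map (f i)).sum := by
    intro f l
    induction l with
    | nil => simp
    | cons a l ih => simp [ih, Finset.sum_add_distrib]
  induction l with
  | nil => simp [pairSum]
  | cons a l ih =>
    simp only [pairSum, ih, Finset.sum_add_distrib]
    rw [hsum (fun i => g i a), hsum (fun i b => g i b a)]

/-! ### Levels and pairs -/

namespace PlaneTree

lemma size_eq_tsum (t : PlaneTree) : (t.size : ℝ≥0∞) = ∑' v, t.mark v := by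
  have h := ENNReal.tsum_set_one (vertexSet t)
  rw [tsum_subtype (vertexSet t) (fun _ => (1 : ℝ≥0∞))] at h
  rw [size, ← ENat.toENNReal_coe, (vertexSet_finite t).cast_ncard_eq, ← h]
  congr 1 with v
  by_cases hv : (t.subtreeAt v).isSome <;> simp [mark, hv, vertexSet, Set.indicator]

lemma size_node_ennreal (l : List PlaneTree) :
    ((node l).size : ℝ≥0∞) = 1 + (l.map fun t => (t.size : ℝ≥0∞)).sum := by
  rw [size_eq_tsum, tsum_list, mark_nil, ← tsum_getElem?_elim]
  congr 2 with i
  simp only [mark_cons]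
  cases l[i]? with
  | none => simp
  | some t => simp [size_eq_tsum]

lemma size_node (l : List PlaneTree) : (node l).size = (l.map size).sum + 1 := by
  have h := size_node_ennreal l
  have h2 : (l.map fun t => (t.size : ℝ≥0∞)).sum = ((l.map size).sum : ℕ) := by
    induction l with
    | nil => simp
    | cons a l ih => simp [ih (size_node_ennreal l)]
  rw [h2, add_comm] at h
  exact_mod_cast h

/-- The number of vertices of `t` at depth `k`. -/
noncomputable def levelCount (k : ℕ) (t : PlaneTree) : ℝ≥0∞ :=
  ∑' v : List ℕ, if v.length = k then t.mark v else 0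

lemma levelCount_zero (t : PlaneTree) : levelCount 0 t = 1 := by
  rw [levelCount, tsum_list]
  simp [mark_nil]

lemma levelCount_succ_node (k : ℕ) (l : List PlaneTree) :
    levelCount (k + 1) (node l) = (l.map (levelCount k)).sum := by
  rw [levelCount, tsum_list, ← tsum_getElem?_elim]
  simp only [List.length_nil, List.length_cons, mark_cons, Nat.add_right_cancel_iff]
  rw [if_neg (by omega), zero_add]
  congr 1 with i
  cases l[i]? with
  | none => simp
  | some t => simp [levelCount]

/-- The number of ordered pairs of vertices of `t` at distance `k`. -/
noncomputable def orderedPairs (k : ℕ) (t : PlaneTree) : ℝ≥0∞ :=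
  ∑' v : List ℕ, ∑' w : List ℕ, if treeDist v w = k then t.mark v * t.mark w else 0

lemma orderedPairs_le (k : ℕ) (t : PlaneTree) : orderedPairs k t ≤ (t.size : ℝ≥0∞) ^ 2 := by
  rw [sq, size_eq_tsum, ← ENNReal.tsum_mul_right]
  simp only [← ENNReal.tsum_mul_left]
  refine ENNReal.tsum_le_tsum fun v => ENNReal.tsum_le_tsum fun w => ?_
  split_ifs <;> simp

lemma pairCount_le_orderedPairs (k : ℕ) (t : PlaneTree) :
    (pairCount t k : ℝ≥0∞) ≤ orderedPairs k t := by
  set S : Set (List ℕ × List ℕ) :=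
    {x | x.1 ∈ vertexSet t ∧ x.2 ∈ vertexSet t ∧ treeDist x.1 x.2 = k} with hS
  have hfin : S.Finite :=
    ((vertexSet_finite t).prod (vertexSet_finite t)).subset fun x hx => ⟨hx.1, hx.2.1⟩
  have hle : pairCount t k ≤ S.ncard := by
    refine le_trans (Set.ncard_le_ncard ?_ (hfin.image fun x => ({x.1, x.2} : Set (List ℕ))))
      (Set.ncard_image_le hfin)
    rintro s ⟨v, w, hv, hw, rfl, hk⟩
    exact ⟨(v, w), ⟨hv, hw, hk⟩, rfl⟩
  refine (Nat.cast_le.2 hle).trans (le_of_eq ?_)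
  have h := ENNReal.tsum_set_one S
  rw [tsum_subtype S (fun _ => (1 : ℝ≥0∞))] at h
  rw [← ENat.toENNReal_coe, hfin.cast_ncard_eq, ← h, orderedPairs, ENNReal.tsum_prod']
  congr 1 with v
  congr 1 with w
  by_cases hv : (t.subtreeAt v).isSome <;> by_cases hw : (t.subtreeAt w).isSome <;>
    by_cases hk : treeDist v w = k <;>
      simp [mark, hv, hw, hk, vertexSet, Set.indicator, hS]

end PlaneTree

lemma treeDist_nil_left (w : List ℕ) : treeDist [] w = w.length := by
  simp [treeDist, dUp, lca]

lemma treeDist_nil_right (v : List ℕ) : treeDist v [] = v.length := by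
  cases v <;> simp [treeDist, dUp, lca]

lemma treeDist_cons_cons (i j : ℕ) (v w : List ℕ) :
    treeDist (i :: v) (j :: w) = if i = j then treeDist v w else v.length + w.length + 2 := by
  by_cases h : i = j
  · subst h; simp [treeDist, dUp, lca]
  · simp [treeDist, dUp, lca, h, Ne.symm h]; omega

namespace PlaneTree

/-- The pairs `(a, b)` with `(a + 1) + (b + 1) = k`. -/
def branchLengths (k : ℕ) : Finset (ℕ × ℕ) :=
  if 2 ≤ k then Finset.HasAntidiagonal.antidiagonal (k - 2) else ∅

lemma mem_branchLengths {k : ℕ} {x : ℕ × ℕ} : x ∈ branchLengths k ↔ x.1 + x.2 + 2 = k := by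
  rw [branchLengths]
  split_ifs with h
  · rw [Finset.HasAntidiagonal.mem_antidiagonal]; omega
  · simp only [Finset.notMem_empty, false_iff]; omega

lemma card_branchLengths_le (k : ℕ) : (branchLengths k).card ≤ k := by
  rw [branchLengths]
  split_ifs with h
  · rw [Finset.Nat.card_antidiagonal]; omega
  · simp

lemma tsum_branches (k : ℕ) (t t' : PlaneTree) :
    (∑' v : List ℕ, ∑' w : List ℕ,
      if v.length + w.length + 2 = k then t.mark v * t'.mark w else 0) =
      ∑ x ∈ branchLengths k, levelCount x.1 t * levelCount x.2 t' := by
  simp only [levelCount, ← ENNReal.tsum_mul_right]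
  simp only [← ENNReal.tsum_mul_left]
  rw [← Summable.tsum_finsetSum fun _ _ => ENNReal.summable]
  congr 1 with v
  rw [← Summable.tsum_finsetSum fun _ _ => ENNReal.summable]
  congr 1 with w
  split_ifs with h
  · rw [Finset.sum_eq_single (v.length, w.length)]
    · simp
    · rintro ⟨a, b⟩ _ hne
      simp only [ite_mul, mul_ite, zero_mul, mul_zero]
      split_ifs <;> simp_all
    · intro hn
      exact absurd (mem_branchLengths.2 h) hn
  · rw [Finset.sum_eq_zero]
    rintro ⟨a, b⟩ hab
    have := mem_branchLengths.1 hab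
    simp only [ite_mul, mul_ite, zero_mul, mul_zero]
    split_ifs <;> simp_all

/-- Decomposition of the ordered pairs at distance `k` according to whether their last common
ancestor is the root. -/
lemma orderedPairs_node {k : ℕ} (hk : k ≠ 0) (l : List PlaneTree) :
    orderedPairs k (node l) = 2 * levelCount k (node l) +
      ∑ x ∈ branchLengths k, pairSum (fun t t' => levelCount x.1 t * levelCount x.2 t') l +
      (l.map (orderedPairs k)).sum := by
  rw [orderedPairs, tsum_list]
  simp_rw [treeDist_nil_left, mark_nil, one_mul]
  have hcons : ∀ (i : ℕ) (v : List ℕ), (∑' w : List ℕ,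
      if treeDist (i :: v) w = k then (node l).mark (i :: v) * (node l).mark w else 0) =
      (if (i :: v).length = k then (node l).mark (i :: v) else 0) +
      ∑' j : ℕ, ∑' w : List ℕ, if treeDist (i :: v) (j :: w) = k then
        (node l).mark (i :: v) * (node l).mark (j :: w) else 0 := by
    intro i v
    rw [tsum_list]
    simp only [treeDist_nil_right, mark_nil, mul_one]
  simp_rw [hcons, ENNReal.tsum_add]
  have hlev : (∑' (i : ℕ) (v : List ℕ),
      if (i :: v).length = k then (node l).mark (i :: v) else 0) = levelCount k (node l) := by
    rw [levelCount, tsum_list]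
    simp [hk.symm]
  rw [hlev, ← levelCount, ← add_assoc, ← two_mul, add_assoc]
  congr 1
  rw [← pairSum_sum, ← tsum_getElem?_elim, ← tsum_ne_getElem?_elim, ← ENNReal.tsum_add]
  congr 1 with i
  rw [ENNReal.tsum_comm]
  have hdiag : (l[i]?).elim 0 (orderedPairs k) =
      ∑' j : ℕ, if i = j then (l[i]?).elim 0 (orderedPairs k) else 0 := by
    simp
  rw [hdiag, ← ENNReal.tsum_add]
  congr 1 with j
  simp only [treeDist_cons_cons, mark_cons]
  by_cases hij : i = j
  · subst hij
    simp only [if_true, zero_add]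
    cases l[i]? with
    | none => simp
    | some t => simp [orderedPairs]
  · simp only [if_neg hij, add_zero]
    cases l[i]? with
    | none => simp
    | some t =>
      cases l[j]? with
      | none => simp
      | some t' => simp [← tsum_branches]

end PlaneTree

/-! ### Generating functions of Galton–Watson trees -/

/-- The generating function of `E[φ(𝒯); |𝒯| = n]`. -/
noncomputable def treeGF (p : ℕ → ℝ≥0∞) (φ : PlaneTree → ℝ≥0∞) : PowerSeries ℝ≥0∞ :=
  weightGF size fun t => gwProb p t * φ t

/-- The generating function of `ψ` over Galton–Watson forests of `d` trees. -/
noncomputable def forestGF (p : ℕ → ℝ≥0∞) (d : ℕ) (ψ : List PlaneTree → ℝ≥0∞) :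
    PowerSeries ℝ≥0∞ :=
  weightGF (fun l : List PlaneTree => (l.map size).sum) fun l =>
    if l.length = d then (l.map (gwProb p)).prod * ψ l else 0

lemma treeGF_add (p : ℕ → ℝ≥0∞) (φ φ' : PlaneTree → ℝ≥0∞) :
    treeGF p (fun t => φ t + φ' t) = treeGF p φ + treeGF p φ' := by
  simp only [treeGF, mul_add, weightGF_add]

lemma forestGF_add (p : ℕ → ℝ≥0∞) (d : ℕ) (ψ ψ' : List PlaneTree → ℝ≥0∞) :
    forestGF p d (fun l => ψ l + ψ' l) = forestGF p d ψ + forestGF p d ψ' := by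
  rw [forestGF, forestGF, forestGF, ← weightGF_add]
  congr 1 with l
  split_ifs <;> simp [mul_add]

lemma forestGF_zero (p : ℕ → ℝ≥0∞) (ψ : List PlaneTree → ℝ≥0∞) :
    forestGF p 0 ψ = C (ψ []) := by
  ext n
  rw [forestGF, coeff_weightGF, tsum_list, coeff_C]
  simp [eq_comm]

lemma forestGF_succ (p : ℕ → ℝ≥0∞) (d : ℕ) (α : PlaneTree → ℝ≥0∞)
    (β : List PlaneTree → ℝ≥0∞) {ψ : List PlaneTree → ℝ≥0∞}
    (h : ∀ a l, ψ (a :: l) = α a * β l) :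
    forestGF p (d + 1) ψ = treeGF p α * forestGF p d β := by
  rw [treeGF, forestGF, forestGF, ← weightGF_prod]
  ext n
  rw [coeff_weightGF, coeff_weightGF, tsum_list, ENNReal.tsum_prod']
  simp only [List.length_nil, List.length_cons, List.map_cons, List.sum_cons, List.prod_cons, h,
    Nat.add_right_cancel_iff]
  rw [if_neg (show ¬ 0 = d + 1 by omega), ite_self, zero_add]
  congr 1 with a
  congr 1 with l
  split_ifs
  · ring
  · simp
  · rfl

lemma forestGF_one (p : ℕ → ℝ≥0∞) (d : ℕ) :
    forestGF p d (fun _ => 1) = treeGF p (fun _ => 1) ^ d := by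
  induction d with
  | zero => simp [forestGF_zero]
  | succ d ih =>
    rw [forestGF_succ p d (fun _ => 1) (fun _ => 1) (by simp), ih, pow_succ']

lemma forestGF_sum (p : ℕ → ℝ≥0∞) (d : ℕ) (φ : PlaneTree → ℝ≥0∞) :
    forestGF p d (fun l => (l.map φ).sum) =
      d * treeGF p (fun _ => 1) ^ (d - 1) * treeGF p φ := by
  induction d with
  | zero => simp [forestGF_zero]
  | succ d ih =>
    have hψ : forestGF p (d + 1) (fun l => (l.map φ).sum) =
        forestGF p (d + 1) (fun l => (l.head?.elim 0 φ) + (l.tail.map φ).sum) := by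
      congr 1 with l
      cases l <;> simp
    rw [hψ, forestGF_add, forestGF_succ p d φ (fun _ => 1) (by simp),
      forestGF_succ p d (fun _ => 1) (fun l => (l.map φ).sum) (by simp), ih, forestGF_one]
    cases d with
    | zero => simp
    | succ d => simp; ring

lemma forestGF_pairSum (p : ℕ → ℝ≥0∞) (d : ℕ) (φ φ' : PlaneTree → ℝ≥0∞) :
    forestGF p d (pairSum fun t t' => φ t * φ' t') =
      (d * (d - 1) : ℕ) * treeGF p (fun _ => 1) ^ (d - 2) * (treeGF p φ * treeGF p φ') := by
  induction d with
  | zero => simp [forestGF_zero, pairSum]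
  | succ d ih =>
    have hψ : forestGF p (d + 1) (pairSum fun t t' => φ t * φ' t') =
        forestGF p (d + 1) (fun l => l.head?.elim 0 φ * (l.tail.map φ').sum +
          l.head?.elim 0 φ' * (l.tail.map φ).sum + pairSum (fun t t' => φ t * φ' t') l.tail) := by
      congr 1 with l
      cases l <;> simp [pairSum, List.sum_map_mul_left, List.sum_map_mul_right, mul_comm]
    rw [hψ, forestGF_add, forestGF_add,
      forestGF_succ p d φ (fun l => (l.map φ').sum) (by simp),
      forestGF_succ p d φ' (fun l => (l.map φ).sum) (by simp),
      forestGF_succ p d (fun _ => 1) (pairSum fun t t' => φ t * φ' t') (by simp), ih,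
      forestGF_sum, forestGF_sum]
    rcases d with _ | _ | d
    · simp
    · simp; ring
    · simp; ring

lemma treeGF_eq_lcomb (p : ℕ → ℝ≥0∞) {φ : PlaneTree → ℝ≥0∞} (ψ : List PlaneTree → ℝ≥0∞)
    (h : ∀ l, φ (.node l) = ψ l) :
    treeGF p φ = X * lcomb p fun d => forestGF p d ψ := by
  rw [treeGF, ← weightGF_equiv equivList]
  have h1 : (fun l => (equivList l).size) = fun l : List PlaneTree => (l.map size).sum + 1 :=
    funext size_node
  rw [h1, weightGF_succ]
  congr 1
  ext n
  rw [coeff_weightGF, coeff_lcomb]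
  simp only [forestGF, coeff_weightGF, ← ENNReal.tsum_mul_left]
  rw [ENNReal.tsum_comm]
  congr 1 with l
  rw [tsum_eq_single l.length]
  · have h2 : gwProb p (equivList l) = p l.length * (l.map (gwProb p)).prod := gwProb_node p l
    have h3 : φ (equivList l) = ψ l := h l
    rw [h2, h3, if_pos rfl]
    split_ifs
    · rw [mul_assoc]
    · rw [mul_zero]
  · intro d hd
    simp [hd.symm]

/-- The series `G'(T)`: the size-biased offspring of a spine vertex. -/
noncomputable def spineGF (p : ℕ → ℝ≥0∞) : PowerSeries ℝ≥0∞ :=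
  lcomb (fun d => (d : ℝ≥0∞) * p d) fun d => treeGF p (fun _ => 1) ^ (d - 1)

/-- The series `G''(T)`: the offspring of a branching vertex. -/
noncomputable def branchGF (p : ℕ → ℝ≥0∞) : PowerSeries ℝ≥0∞ :=
  lcomb (fun d => ((d * (d - 1) : ℕ) : ℝ≥0∞) * p d) fun d => treeGF p (fun _ => 1) ^ (d - 2)

lemma treeGF_one (p : ℕ → ℝ≥0∞) :
    treeGF p (fun _ => 1) = X * lcomb p fun d => treeGF p (fun _ => 1) ^ d := by
  conv_lhs => rw [treeGF_eq_lcomb p (fun _ => 1) (fun _ => rfl)]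
  simp only [forestGF_one]

lemma lcomb_natCast_mul (p : ℕ → ℝ≥0∞) (c : ℕ → ℕ) (F : ℕ → PowerSeries ℝ≥0∞) :
    (lcomb p fun d => (c d : PowerSeries ℝ≥0∞) * F d) = lcomb (fun d => (c d : ℝ≥0∞) * p d) F := by
  ext n
  rw [coeff_lcomb, coeff_lcomb]
  congr 1 with d
  rw [show (c d : PowerSeries ℝ≥0∞) = C (c d : ℝ≥0∞) by simp, coeff_C_mul]
  ring

lemma treeGF_sum_children (p : ℕ → ℝ≥0∞) {φ φ' : PlaneTree → ℝ≥0∞}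
    (h : ∀ l, φ (.node l) = (l.map φ').sum) :
    treeGF p φ = X * spineGF p * treeGF p φ' := by
  rw [treeGF_eq_lcomb p _ h, spineGF, mul_assoc, lcomb_mul, ← lcomb_natCast_mul]
  simp only [forestGF_sum, mul_assoc]

lemma treeGF_pairSum_children (p : ℕ → ℝ≥0∞) (φ φ₁ φ₂ : PlaneTree → ℝ≥0∞)
    (h : ∀ l, φ (.node l) = pairSum (fun t t' => φ₁ t * φ₂ t') l) :
    treeGF p φ = X * branchGF p * (treeGF p φ₁ * treeGF p φ₂) := by
  rw [treeGF_eq_lcomb p _ h, branchGF, mul_assoc, lcomb_mul, ← lcomb_natCast_mul]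
  simp only [forestGF_pairSum, mul_assoc]

lemma treeGF_levelCount (p : ℕ → ℝ≥0∞) (k : ℕ) :
    treeGF p (levelCount k) = (X * spineGF p) ^ k * treeGF p (fun _ => 1) := by
  induction k with
  | zero => simp [funext levelCount_zero]
  | succ k ih =>
    rw [treeGF_sum_children p (levelCount_succ_node k), ih, pow_succ']
    ring

/-- The Otter–Dwass formula: `n P(|𝒯| = n) = P(S_n = n - 1)`. -/
lemma natCast_mul_probSize (p : ℕ → ℝ≥0∞) {n : ℕ} (hn : 1 ≤ n) :
    (n : ℝ≥0∞) * probSize p n = coeff (n - 1) (PowerSeries.mk p ^ n) := by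
  have h : treeGF p (fun t => (t.size : ℝ≥0∞)) = walkGF p 0 * treeGF p (fun _ => 1) := by
    refine eq_walkGF_mul_of_renewal (treeGF_one p) ?_
    rw [← spineGF]
    rw [← treeGF_sum_children p (φ := fun t => (t.children.map fun t => (t.size : ℝ≥0∞)).sum)
      (fun l => rfl), ← treeGF_add]
    congr 1 with t
    obtain ⟨l⟩ := t
    exact size_node_ennreal l
  have h1 := walkGF_zero_mul_pow (treeGF_one p) 1
  rw [pow_one] at h1
  rw [h1] at h
  have h2 := congrArg (coeff n) h
  rw [coeff_walkGF, if_pos hn, treeGF, coeff_weightGF] at h2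
  rw [← h2, probSize, ← ENNReal.tsum_mul_left]
  congr 1 with t
  split_ifs with ht
  · rw [ht, mul_comm]
  · simp

/-- The generating function of the ordered pairs at distance `k`. -/
lemma treeGF_orderedPairs (p : ℕ → ℝ≥0∞) {k : ℕ} (hk : k ≠ 0) :
    treeGF p (orderedPairs k) = walkGF p 0 *
      (2 * ((X * spineGF p) ^ k * treeGF p (fun _ => 1)) +
        ((branchLengths k).card : PowerSeries ℝ≥0∞) * (X * branchGF p *
          ((X * spineGF p) ^ (k - 2) * treeGF p (fun _ => 1) ^ 2))) := by
  refine eq_walkGF_mul_of_renewal (treeGF_one p) ?_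
  rw [← spineGF, ← treeGF_sum_children p (φ := fun t => (t.children.map (orderedPairs k)).sum)
    (fun l => rfl), ← treeGF_levelCount]
  have hpair : ((branchLengths k).card : PowerSeries ℝ≥0∞) * (X * branchGF p *
      ((X * spineGF p) ^ (k - 2) * treeGF p (fun _ => 1) ^ 2)) =
      treeGF p fun t => ∑ x ∈ branchLengths k,
        pairSum (fun t t' => levelCount x.1 t * levelCount x.2 t') t.children := by
    simp only [treeGF, Finset.mul_sum, weightGF_sum]
    rw [← nsmul_eq_mul]
    symm
    refine Finset.sum_eq_card_nsmul fun x hx => ?_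
    have := treeGF_pairSum_children p
      (fun t => pairSum (fun t t' => levelCount x.1 t * levelCount x.2 t') t.children)
      (levelCount x.1) (levelCount x.2) (fun l => rfl)
    rw [treeGF, treeGF_levelCount, treeGF_levelCount] at this
    rw [this, ← treeGF, show k - 2 = x.1 + x.2 by have := mem_branchLengths.1 hx; omega, pow_add]
    ring
  rw [hpair, two_mul, ← treeGF_add, ← treeGF_add, ← treeGF_add]
  congr 1 with t
  obtain ⟨l⟩ := t
  rw [orderedPairs_node hk, two_mul]
  rfl

/-! ### The combinatorial bound -/

lemma coeff_mul_lcomb_le {A : PowerSeries ℝ≥0∞} {c : ℕ → ℝ≥0∞} {F : ℕ → PowerSeries ℝ≥0∞}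
    {M : ℕ} {b : ℝ≥0∞} (h : ∀ d, coeff M (A * F d) ≤ b) :
    coeff M (A * lcomb c F) ≤ (∑' d, c d) * b := by
  rw [mul_lcomb, coeff_lcomb, ← ENNReal.tsum_mul_right]
  exact ENNReal.tsum_le_tsum fun d => mul_le_mul_right (h d) _

lemma coeff_walk_mul_spine_le {p : ℕ → ℝ≥0∞} (hmean : ∑' k : ℕ, (k : ℝ≥0∞) * p k = 1)
    {M : ℕ} {b : ℝ≥0∞} (hb : ∀ j, coeff j (PowerSeries.mk p ^ M) ≤ b) (m N : ℕ) :
    coeff M (walkGF p 0 * treeGF p (fun _ => 1) ^ N * spineGF p ^ m) ≤ b := by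
  induction m generalizing N with
  | zero =>
    rw [pow_zero, mul_one, walkGF_zero_mul_pow (treeGF_one p), coeff_walkGF]
    split_ifs
    · exact hb _
    · simp
  | succ m ih =>
    rw [pow_succ, ← mul_assoc]
    nth_rw 2 [spineGF]
    refine (coeff_mul_lcomb_le (b := b) fun d => ?_).trans (by rw [hmean, one_mul])
    refine le_trans (le_of_eq ?_) (ih (N + (d - 1)))
    rw [pow_add]
    ring_nf

lemma coeff_treeGF_orderedPairs_le {p : ℕ → ℝ≥0∞} (hmean : ∑' k : ℕ, (k : ℝ≥0∞) * p k = 1)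
    {n k : ℕ} (hk : 1 ≤ k) (hkn : k ≤ n) {b : ℝ≥0∞}
    (hb : ∀ M, n - k ≤ M → ∀ j, coeff j (PowerSeries.mk p ^ M) ≤ b) :
    coeff n (treeGF p (orderedPairs k)) ≤
      (2 + k * ∑' d : ℕ, ((d * (d - 1) : ℕ) : ℝ≥0∞) * p d) * b := by
  set T := treeGF p (fun _ => 1) with hT
  set v := ∑' d : ℕ, ((d * (d - 1) : ℕ) : ℝ≥0∞) * p d with hv
  have h1 : coeff n (walkGF p 0 * T * spineGF p ^ k * X ^ k) ≤ b := by
    rw [coeff_mul_X_pow', if_pos hkn]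
    simpa using coeff_walk_mul_spine_le hmean (hb (n - k) le_rfl) k 1
  have h2 : (branchLengths k).card * coeff n
      (walkGF p 0 * T ^ 2 * spineGF p ^ (k - 2) * branchGF p * X ^ (k - 1)) ≤ k * (v * b) := by
    refine mul_le_mul' (by exact_mod_cast card_branchLengths_le k) ?_
    rw [coeff_mul_X_pow', if_pos (by omega), branchGF]
    refine coeff_mul_lcomb_le fun d => ?_
    refine le_trans (le_of_eq ?_)
      (coeff_walk_mul_spine_le hmean (hb (n - (k - 1)) (by omega)) (k - 2) (2 + (d - 2)))
    rw [pow_add, hT]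
    ring_nf
  have hdecomp : treeGF p (orderedPairs k) =
      C 2 * (walkGF p 0 * T * spineGF p ^ k * X ^ k) + C ((branchLengths k).card : ℝ≥0∞) *
        (walkGF p 0 * T ^ 2 * spineGF p ^ (k - 2) * branchGF p * X ^ (k - 1)) := by
    rw [treeGF_orderedPairs p (by omega), ← hT]
    simp only [mul_pow, map_natCast, map_ofNat]
    rcases Nat.lt_or_ge k 2 with hk2 | hk2
    · simp only [branchLengths, not_le.2 hk2, if_false, Finset.card_empty, Nat.cast_zero]
      ring
    · rw [show k - 1 = (k - 2) + 1 by omega]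
      ring
  rw [hdecomp, map_add, coeff_C_mul, coeff_C_mul, add_mul, mul_assoc (k : ℝ≥0∞)]
  exact add_le_add (mul_le_mul_right h1 _) h2

section LocalLimit

open MeasureTheory

/-- The characteristic function of the (sub)probability weights `r` on `ℕ`. -/
noncomputable def charSeries (r : ℕ → ℝ) (t : ℝ) : ℂ :=
  ∑' k : ℕ, (r k : ℂ) * Complex.exp (k * t * Complex.I)

variable {r : ℕ → ℝ}

lemma coeff_mk_pow_nonneg (hr : ∀ k, 0 ≤ r k) (n j : ℕ) :
    0 ≤ coeff j (PowerSeries.mk r ^ n) := by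
  induction n generalizing j with
  | zero => rw [pow_zero, coeff_one]; split_ifs <;> simp
  | succ n ih =>
    rw [pow_succ, coeff_mul]
    exact Finset.sum_nonneg fun x _ => mul_nonneg (ih _) (by simpa using hr _)

lemma dvd_of_coeff_mk_pow_ne_zero {h : ℕ} (hh : ∀ k, r k ≠ 0 → h ∣ k) {n j : ℕ}
    (hj : coeff j (PowerSeries.mk r ^ n) ≠ 0) : h ∣ j := by
  induction n generalizing j with
  | zero =>
    rw [pow_zero, coeff_one] at hj
    have : j = 0 := by by_contra h; simp [h] at hj
    simp [this]
  | succ n ih =>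
    rw [pow_succ, coeff_mul] at hj
    obtain ⟨x, hx, hne⟩ := Finset.exists_ne_zero_of_sum_ne_zero hj
    rw [Finset.HasAntidiagonal.mem_antidiagonal] at hx
    rw [← hx]
    exact dvd_add (ih (left_ne_zero_of_mul hne))
      (hh _ (by simpa using right_ne_zero_of_mul hne))

lemma norm_exp_natCast_mul (k : ℕ) (t : ℝ) : ‖Complex.exp (k * t * Complex.I)‖ = 1 := by
  have := Complex.norm_exp_ofReal_mul_I (k * t)
  push_cast at this
  exact this

lemma summable_norm_and_tsum_eq_of_antidiagonal {f g u : ℕ → ℂ} (hf : Summable fun j => ‖f j‖)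
    (hg : Summable fun j => ‖g j‖)
    (hu : ∀ j, u j = ∑ kl ∈ Finset.HasAntidiagonal.antidiagonal j, f kl.1 * g kl.2) :
    (Summable fun j => ‖u j‖) ∧ ∑' j, u j = (∑' j, f j) * ∑' j, g j := by
  rw [funext hu, tsum_mul_tsum_eq_tsum_sum_antidiagonal_of_summable_norm hf hg]
  exact ⟨summable_norm_sum_mul_antidiagonal_of_summable_norm hf hg, rfl⟩

lemma coeff_mk_pow_hasSum (hr : ∀ k, 0 ≤ r k) (hs : Summable r) (n : ℕ) (t : ℝ) :
    Summable (fun j => coeff j (PowerSeries.mk r ^ n)) ∧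
    HasSum (fun j : ℕ => ((coeff j (PowerSeries.mk r ^ n) : ℝ) : ℂ) *
      Complex.exp (j * t * Complex.I)) (charSeries r t ^ n) := by
  have key : Summable (fun j : ℕ => ‖((coeff j (PowerSeries.mk r ^ n) : ℝ) : ℂ) *
      Complex.exp (j * t * Complex.I)‖) ∧
      ∑' j : ℕ, ((coeff j (PowerSeries.mk r ^ n) : ℝ) : ℂ) *
        Complex.exp (j * t * Complex.I) = charSeries r t ^ n := by
    induction n with
    | zero =>
      have h0 : ∀ j ∉ ({0} : Finset ℕ), ((coeff j (PowerSeries.mk r ^ 0) : ℝ) : ℂ) *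
          Complex.exp (j * t * Complex.I) = 0 := by
        intro j hj
        have : j ≠ 0 := by simpa using hj
        simp [coeff_one, this]
      refine ⟨summable_of_ne_finset_zero (s := {0}) fun j hj => by rw [h0 j hj, norm_zero], ?_⟩
      rw [tsum_eq_sum h0]
      simp
    | succ n ih =>
      have hs1 : Summable (fun k : ℕ => ‖(r k : ℂ) * Complex.exp (k * t * Complex.I)‖) := by
        simpa [norm_exp_natCast_mul, abs_of_nonneg (hr _)] using hs
      have hterm : ∀ j : ℕ, ((coeff j (PowerSeries.mk r ^ (n + 1)) : ℝ) : ℂ) *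
          Complex.exp (j * t * Complex.I) =
          ∑ kl ∈ Finset.HasAntidiagonal.antidiagonal j,
            (((coeff kl.1 (PowerSeries.mk r ^ n) : ℝ) : ℂ) *
              Complex.exp (kl.1 * t * Complex.I)) *
            ((r kl.2 : ℂ) * Complex.exp (kl.2 * t * Complex.I)) := by
        intro j
        rw [pow_succ, coeff_mul, Complex.ofReal_sum, Finset.sum_mul]
        refine Finset.sum_congr rfl fun x hx => ?_
        rw [Finset.HasAntidiagonal.mem_antidiagonal] at hx
        rw [← hx]
        push_cast
        rw [show ((x.1 : ℂ) + x.2) * t * Complex.I =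
          x.1 * t * Complex.I + x.2 * t * Complex.I by ring, Complex.exp_add, coeff_mk]
        ring
      obtain ⟨h1, h2⟩ := summable_norm_and_tsum_eq_of_antidiagonal ih.1 hs1 hterm
      exact ⟨h1, by rw [h2, ih.2, pow_succ]; rfl⟩
  refine ⟨?_, key.2 ▸ key.1.of_norm.hasSum⟩
  simpa [norm_exp_natCast_mul, abs_of_nonneg (coeff_mk_pow_nonneg hr _ _)] using key.1

lemma integral_exp_int_mul {h : ℕ} (hh : h ≠ 0) {m : ℤ} (hm : (h : ℤ) ∣ m) (hm0 : m ≠ 0) :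
    ∫ t in (-(Real.pi / h))..(Real.pi / h), Complex.exp (m * Complex.I * t) = 0 := by
  obtain ⟨q, rfl⟩ := hm
  have hhC : (h : ℂ) ≠ 0 := by exact_mod_cast hh
  rw [integral_exp_mul_complex (mul_ne_zero (by exact_mod_cast hm0) Complex.I_ne_zero),
    div_eq_zero_iff, sub_eq_zero, Complex.exp_eq_exp_iff_exists_int]
  refine Or.inl ⟨q, ?_⟩
  push_cast
  field_simp
  ring

/-- Fourier inversion for the coefficients of a power of a power series with exponents in `hℕ`. -/
lemma coeff_mk_pow_eq_integral (hr : ∀ k, 0 ≤ r k) (hs : Summable r) {h : ℕ} (hh0 : h ≠ 0)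
    (hh : ∀ k, r k ≠ 0 → h ∣ k) (n : ℕ) {j : ℕ} (hj : h ∣ j) :
    ∫ t in (-(Real.pi / h))..(Real.pi / h),
      charSeries r t ^ n * Complex.exp (-(j * t * Complex.I)) =
      ((2 * Real.pi / h * coeff j (PowerSeries.mk r ^ n) : ℝ) : ℂ) := by
  have H := intervalIntegral.hasSum_integral_of_dominated_convergence (μ := MeasureTheory.volume)
    (a := -(Real.pi / h)) (b := Real.pi / h)
    (F := fun (m : ℕ) (t : ℝ) => ((coeff m (PowerSeries.mk r ^ n) : ℝ) : ℂ) *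
      Complex.exp (m * t * Complex.I) * Complex.exp (-(j * t * Complex.I)))
    (f := fun t => charSeries r t ^ n * Complex.exp (-(j * t * Complex.I)))
    (fun m _ => coeff m (PowerSeries.mk r ^ n))
    (fun m => by fun_prop)
    (fun m => by
      refine Eventually.of_forall fun t _ => ?_
      rw [norm_mul, norm_mul, norm_exp_natCast_mul, Complex.exp_neg, norm_inv,
        norm_exp_natCast_mul]
      simp [abs_of_nonneg (coeff_mk_pow_nonneg hr _ _)])
    (Eventually.of_forall fun t _ => (coeff_mk_pow_hasSum hr hs n t).1)
    (by simp)
    (Eventually.of_forall fun t _ => (coeff_mk_pow_hasSum hr hs n t).2.mul_right _)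
  refine H.unique ?_
  convert hasSum_single j ?_ using 1
  · simp_rw [mul_assoc, ← Complex.exp_add, add_neg_cancel, Complex.exp_zero, mul_one]
    rw [intervalIntegral.integral_const, Complex.real_smul]
    push_cast
    ring
  · intro m hmj
    by_cases hc : coeff m (PowerSeries.mk r ^ n) = 0
    · simp [hc]
    have hd := dvd_of_coeff_mk_pow_ne_zero hh hc
    have := integral_exp_int_mul hh0 (m := (m : ℤ) - j)
      (dvd_sub (by exact_mod_cast hd) (by exact_mod_cast hj)) (by omega)
    simp_rw [mul_assoc, ← Complex.exp_add]
    rw [intervalIntegral.integral_const_mul, mul_eq_zero]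
    right
    rw [← this]
    congr 1 with t
    push_cast
    ring_nf

lemma summable_norm_charSeries_term (hr : ∀ k, 0 ≤ r k) (hs : Summable r) (t : ℝ) :
    Summable fun k : ℕ => ‖(r k : ℂ) * Complex.exp (k * t * Complex.I)‖ := by
  simpa [norm_exp_natCast_mul, abs_of_nonneg (hr _)] using hs

lemma continuous_charSeries (hr : ∀ k, 0 ≤ r k) (hs : Summable r) :
    Continuous (charSeries r) := by
  refine continuous_tsum (fun k => by fun_prop) hs fun k t => ?_
  simp [norm_exp_natCast_mul, abs_of_nonneg (hr _)]

lemma hasSum_mul_one_sub_cos (hr : ∀ k, 0 ≤ r k) (hs : HasSum r 1) (t : ℝ) :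
    HasSum (fun k : ℕ => r k * (1 - Real.cos (k * t))) (1 - (charSeries r t).re) := by
  have h1 := (summable_norm_charSeries_term hr hs.summable t).of_norm.hasSum
  have h2 : HasSum (fun k : ℕ => r k -
      ((r k : ℂ) * Complex.exp (k * t * Complex.I)).re) (1 - (charSeries r t).re) :=
    hs.sub (Complex.hasSum_re h1)
  have hterm : ∀ k : ℕ, r k * (1 - Real.cos (k * t)) =
      r k - ((r k : ℂ) * Complex.exp (k * t * Complex.I)).re := by
    intro k
    have : Complex.exp (k * t * Complex.I) = Complex.exp (((k * t : ℝ) : ℂ) * Complex.I) := by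
      push_cast; rfl
    rw [Complex.re_ofReal_mul, this, Complex.exp_ofReal_mul_I_re]
    ring
  rwa [funext hterm]

lemma norm_charSeries_sq_le (hr : ∀ k, 0 ≤ r k) (hs : HasSum r 1) (t : ℝ) :
    ‖charSeries r t‖ ^ 2 ≤ 1 - 2 * r 0 * (1 - (charSeries r t).re) := by
  have hsum := summable_norm_charSeries_term hr hs.summable t
  have h0 : charSeries r t = r 0 + ∑' k : ℕ,
      (r (k + 1) : ℂ) * Complex.exp ((k + 1 : ℕ) * t * Complex.I) := by
    rw [charSeries, hsum.of_norm.tsum_eq_zero_add]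
    simp
  set R := ∑' k : ℕ, (r (k + 1) : ℂ) * Complex.exp ((k + 1 : ℕ) * t * Complex.I) with hR
  have hRn : ‖R‖ ≤ 1 - r 0 := by
    have h1 : 1 = r 0 + ∑' k, r (k + 1) := by
      rw [← hs.summable.tsum_eq_zero_add, hs.tsum_eq]
    have h2 : ‖R‖ ≤ ∑' k : ℕ, ‖(r (k + 1) : ℂ) * Complex.exp ((k + 1 : ℕ) * t * Complex.I)‖ :=
      norm_tsum_le_tsum_norm ((summable_nat_add_iff (f := fun k : ℕ =>
        ‖(r k : ℂ) * Complex.exp (k * t * Complex.I)‖) 1).2 hsum)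
    simp only [norm_mul, norm_exp_natCast_mul, Complex.norm_real, Real.norm_eq_abs,
      abs_of_nonneg (hr _), mul_one] at h2
    linarith
  have hR2 : ‖R‖ ^ 2 ≤ (1 - r 0) ^ 2 := pow_le_pow_left₀ (norm_nonneg _) hRn 2
  rw [Complex.sq_norm, Complex.normSq_apply] at hR2
  rw [Complex.sq_norm, Complex.normSq_apply, h0]
  simp only [Complex.add_re, Complex.add_im, Complex.ofReal_re, Complex.ofReal_im]
  nlinarith

/-- The span (maximal lattice spacing) of the support of `r`. -/
lemma exists_span {k₀ : ℕ} (hk₀ : k₀ ≠ 0) (hrk : r k₀ ≠ 0) :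
    ∃ h : ℕ, h ≠ 0 ∧ (∀ k, r k ≠ 0 → h ∣ k) ∧
      ∀ t : ℝ, (∀ k : ℕ, r k ≠ 0 → Real.cos (k * t) = 1) → Real.cos (h * t) = 1 := by
  obtain ⟨a, ha⟩ := Int.subgroup_cyclic
    (AddSubgroup.closure {m : ℤ | ∃ k : ℕ, r k ≠ 0 ∧ m = k})
  have hdvd : ∀ k, r k ≠ 0 → a.natAbs ∣ k := by
    intro k hk
    have hmem : (k : ℤ) ∈ AddSubgroup.closure {m : ℤ | ∃ k : ℕ, r k ≠ 0 ∧ m = k} :=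
      AddSubgroup.subset_closure ⟨k, hk, rfl⟩
    rw [ha, AddSubgroup.mem_closure_singleton] at hmem
    obtain ⟨q, hq⟩ := hmem
    rw [← Int.natCast_dvd_natCast, Int.natAbs_dvd]
    exact ⟨q, by rw [← hq, smul_eq_mul, mul_comm]⟩
  refine ⟨a.natAbs, fun h0 => hk₀ (by simpa [h0] using hdvd k₀ hrk), hdvd, fun t ht => ?_⟩
  have key : ∀ m ∈ AddSubgroup.closure {m : ℤ | ∃ k : ℕ, r k ≠ 0 ∧ m = k},
      ∃ q : ℤ, (q : ℝ) * (2 * Real.pi) = m * t := by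
    intro m hm
    induction hm using AddSubgroup.closure_induction with
    | mem x hx =>
      obtain ⟨k, hk, rfl⟩ := hx
      simpa using (Real.cos_eq_one_iff _).1 (ht k hk)
    | zero => exact ⟨0, by simp⟩
    | add x y _ _ hx hy =>
      obtain ⟨⟨q, hq⟩, ⟨q', hq'⟩⟩ := hx, hy
      exact ⟨q + q', by push_cast; linarith⟩
    | neg x _ hx =>
      obtain ⟨q, hq⟩ := hx
      exact ⟨-q, by push_cast; linarith⟩
  have hcos : Real.cos (a * t) = 1 := by
    rw [Real.cos_eq_one_iff]
    exact key a (ha ▸ AddSubgroup.subset_closure rfl)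
  rw [Nat.cast_natAbs, Int.cast_abs]
  rcases abs_choice (a : ℝ) with h | h <;> rw [h]
  · exact hcos
  · rwa [neg_mul, Real.cos_neg]

lemma exists_mul_sq_le_one_sub_re (hr : ∀ k, 0 ≤ r k) (hs : HasSum r 1) {k₀ : ℕ} (hk₀ : k₀ ≠ 0)
    (hrk : r k₀ ≠ 0) {h : ℕ} (hh0 : h ≠ 0)
    (hspan : ∀ t : ℝ, (∀ k : ℕ, r k ≠ 0 → Real.cos (k * t) = 1) → Real.cos (h * t) = 1) :
    ∃ c : ℝ, 0 < c ∧ ∀ t : ℝ, |t| ≤ Real.pi / h → c * t ^ 2 ≤ 1 - (charSeries r t).re := by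
  have hπ := Real.pi_pos
  have hk : (0 : ℝ) < k₀ := by positivity
  have hhpos : (0 : ℝ) < h := by positivity
  have hrpos : 0 < r k₀ := lt_of_le_of_ne (hr _) hrk.symm
  have hnn : ∀ (t : ℝ) (k : ℕ), 0 ≤ r k * (1 - Real.cos (k * t)) := fun t k =>
    mul_nonneg (hr k) (sub_nonneg.2 (Real.cos_le_one _))
  have hK : IsCompact {t : ℝ | Real.pi / k₀ ≤ |t| ∧ |t| ≤ Real.pi / h} := by
    refine (isCompact_Icc (a := -(Real.pi / h)) (b := Real.pi / h)).of_isClosed_subset ?_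
      fun t ht => abs_le.1 ht.2
    exact (isClosed_le continuous_const continuous_abs).inter
      (isClosed_le continuous_abs continuous_const)
  have hpos : ∀ t ∈ {t : ℝ | Real.pi / k₀ ≤ |t| ∧ |t| ≤ Real.pi / h},
      0 < 1 - (charSeries r t).re := by
    intro t ht
    have hsum := hasSum_mul_one_sub_cos hr hs t
    refine lt_of_le_of_ne (hsum.nonneg (hnn t)) fun h0 => ?_
    rw [← h0, hasSum_zero_iff_of_nonneg (hnn t)] at hsum
    have hcos := hspan t fun k hk' => by
      have := congrFun hsum k
      simp only [Pi.zero_apply, mul_eq_zero, hk', false_or] at this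
      linarith
    have hle : |h * t| ≤ Real.pi := by
      rw [abs_mul, abs_of_pos hhpos]
      have := ht.2
      rw [le_div_iff₀ hhpos] at this
      linarith
    rw [Real.cos_eq_one_iff_of_lt_of_lt (by linarith [(abs_le.1 hle).1])
      (by linarith [(abs_le.1 hle).2])] at hcos
    have ht0 : t = 0 := (mul_eq_zero.1 hcos).resolve_left hhpos.ne'
    have := ht.1
    rw [ht0, abs_zero] at this
    exact absurd this (not_le.2 (by positivity))
  obtain ⟨m, hm0, hm⟩ := hK.exists_forall_le' (f := fun t => 1 - (charSeries r t).re)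
    (by have := continuous_charSeries hr hs.summable; fun_prop) hpos
  refine ⟨min (r k₀ * (2 / Real.pi ^ 2 * k₀ ^ 2)) (m / (Real.pi / h) ^ 2), by positivity,
    fun t ht => ?_⟩
  rcases le_total |t| (Real.pi / k₀) with hc | hc
  · have hle : |k₀ * t| ≤ Real.pi := by
      rw [abs_mul, abs_of_pos hk]
      rw [le_div_iff₀ hk] at hc
      linarith
    have h1 := Real.cos_le_one_sub_mul_cos_sq hle
    have h2 := le_hasSum (hasSum_mul_one_sub_cos hr hs t) k₀ fun k _ => hnn t k
    calc _ ≤ r k₀ * (2 / Real.pi ^ 2 * k₀ ^ 2) * t ^ 2 := by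
          gcongr; exact min_le_left _ _
      _ = r k₀ * (2 / Real.pi ^ 2 * (k₀ * t) ^ 2) := by ring
      _ ≤ r k₀ * (1 - Real.cos (k₀ * t)) := by gcongr; linarith
      _ ≤ _ := h2
  · calc _ ≤ m / (Real.pi / h) ^ 2 * (Real.pi / h) ^ 2 := by
          have : t ^ 2 ≤ (Real.pi / h) ^ 2 := sq_le_sq' (abs_le.1 ht).1 (abs_le.1 ht).2
          gcongr
          exact min_le_right _ _
      _ = m := by field_simp
      _ ≤ _ := hm t ⟨hc, ht⟩

lemma exists_norm_charSeries_le_exp (hr : ∀ k, 0 ≤ r k) (hs : HasSum r 1) (hr0 : r 0 ≠ 0)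
    {k₀ : ℕ} (hk₀ : k₀ ≠ 0) (hrk : r k₀ ≠ 0) {h : ℕ} (hh0 : h ≠ 0)
    (hspan : ∀ t : ℝ, (∀ k : ℕ, r k ≠ 0 → Real.cos (k * t) = 1) → Real.cos (h * t) = 1) :
    ∃ a : ℝ, 0 < a ∧ ∀ t : ℝ, |t| ≤ Real.pi / h →
      ‖charSeries r t‖ ≤ Real.exp (-a * t ^ 2) := by
  obtain ⟨c, hc, hct⟩ := exists_mul_sq_le_one_sub_re hr hs hk₀ hrk hh0 hspan
  have hr0' : 0 < r 0 := lt_of_le_of_ne (hr _) hr0.symm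
  refine ⟨r 0 * c, by positivity, fun t ht => ?_⟩
  refine le_of_sq_le_sq ?_ (Real.exp_pos _).le
  calc ‖charSeries r t‖ ^ 2 ≤ 1 - 2 * r 0 * (1 - (charSeries r t).re) :=
        norm_charSeries_sq_le hr hs t
    _ ≤ 1 - 2 * r 0 * (c * t ^ 2) := by gcongr; exact hct t ht
    _ ≤ Real.exp (-(2 * r 0 * (c * t ^ 2))) := Real.one_sub_le_exp_neg _
    _ = _ := by rw [← Real.exp_nat_mul]; push_cast; ring_nf

lemma exists_coeff_mk_pow_le (hr : ∀ k, 0 ≤ r k) (hs : HasSum r 1) {h : ℕ} (hh0 : h ≠ 0)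
    (hh : ∀ k, r k ≠ 0 → h ∣ k) {a : ℝ} (ha : 0 < a)
    (hexp : ∀ t : ℝ, |t| ≤ Real.pi / h → ‖charSeries r t‖ ≤ Real.exp (-a * t ^ 2)) :
    ∃ C : ℝ, 0 < C ∧ ∀ m : ℕ, 1 ≤ m → ∀ j, coeff j (PowerSeries.mk r ^ m) ≤ C / √m := by
  have hπ := Real.pi_pos
  have hhpos : (0 : ℝ) < h := by positivity
  refine ⟨h / (2 * Real.pi) * √(Real.pi / a), by positivity, fun m hm j => ?_⟩
  have hm' : (0 : ℝ) < m := by exact_mod_cast hm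
  by_cases hj : h ∣ j
  swap
  · have : coeff j (PowerSeries.mk r ^ m) = 0 := by
      by_contra h0
      exact hj (dvd_of_coeff_mk_pow_ne_zero hh h0)
    rw [this]
    positivity
  have hab : -(Real.pi / h) ≤ Real.pi / h := by
    have : 0 < Real.pi / h := by positivity
    linarith
  have hint : Integrable fun t : ℝ => Real.exp (-(a * m) * t ^ 2) :=
    integrable_exp_neg_mul_sq (by positivity)
  have h1 : ‖∫ t in (-(Real.pi / h))..(Real.pi / h),
      charSeries r t ^ m * Complex.exp (-(j * t * Complex.I))‖ ≤ √(Real.pi / (a * m)) := by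
    calc _ ≤ ∫ t in (-(Real.pi / h))..(Real.pi / h), Real.exp (-(a * m) * t ^ 2) := by
          refine intervalIntegral.norm_integral_le_of_norm_le hab
            (Eventually.of_forall fun t ht => ?_) hint.intervalIntegrable
          rw [norm_mul, norm_pow, Complex.exp_neg, norm_inv, norm_exp_natCast_mul, inv_one,
            mul_one]
          calc _ ≤ Real.exp (-a * t ^ 2) ^ m := by
                gcongr
                exact hexp t (abs_le.2 ⟨ht.1.le, ht.2⟩)
            _ = _ := by rw [← Real.exp_nat_mul]; ring_nf
      _ ≤ ∫ t : ℝ, Real.exp (-(a * m) * t ^ 2) := by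
          rw [intervalIntegral.integral_of_le hab]
          exact setIntegral_le_integral hint (Eventually.of_forall fun t => (Real.exp_pos _).le)
      _ = _ := integral_gaussian _
  rw [coeff_mk_pow_eq_integral hr hs.summable hh0 hh m hj, Complex.norm_real, Real.norm_eq_abs,
    abs_of_nonneg (mul_nonneg (by positivity) (coeff_mk_pow_nonneg hr _ _)), ← div_div,
    Real.sqrt_div (by positivity)] at h1
  calc coeff j (PowerSeries.mk r ^ m)
      = h / (2 * Real.pi) * (2 * Real.pi / h * coeff j (PowerSeries.mk r ^ m)) := by
        field_simp
    _ ≤ h / (2 * Real.pi) * (√(Real.pi / a) / √m) := by gcongr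
    _ = _ := by ring

lemma tendsto_charSeries_pow (hr : ∀ k, 0 ≤ r k) (hs : HasSum r 1)
    (hmean : HasSum (fun k : ℕ => (k : ℝ) * r k) 1) {V : ℝ} (hV : 0 < V)
    (hvar : HasSum (fun k : ℕ => r k * ((k : ℝ) - 1) ^ 2) V) (s : ℝ) :
    Tendsto (fun n : ℕ => (charSeries r (s / √n) *
      Complex.exp (-((s / √n : ℝ) * Complex.I))) ^ n) atTop
      (nhds (Complex.exp (-(V * s ^ 2) / 2))) := by
  set P : Measure ℕ := Measure.sum fun k : ℕ => ENNReal.ofReal (r k) • Measure.dirac k with hP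
  have htop : ∀ k, ENNReal.ofReal (r k) ≠ ∞ := fun k => ENNReal.ofReal_ne_top
  have hprob : IsProbabilityMeasure P := by
    constructor
    rw [hP, Measure.sum_apply _ MeasurableSet.univ]
    simp [← ENNReal.ofReal_tsum_of_nonneg hr hs.summable, hs.tsum_eq]
  have hsq : √V ≠ 0 := (Real.sqrt_pos.2 hV).ne'
  have hmX : Measurable fun k : ℕ => ((k : ℝ) - 1) / √V := measurable_of_countable _
  have hm0 : ∫ k : ℕ, ((k : ℝ) - 1) / √V ∂P = 0 := by
    rw [hP, integral_sum_dirac htop]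
    have := (hmean.sub hs).div_const √V
    rw [sub_self, zero_div] at this
    rw [← this.tsum_eq]
    congr 1 with k
    rw [ENNReal.toReal_ofReal (hr k), smul_eq_mul]
    ring
  have hm1 : ∫ k : ℕ, ((fun k : ℕ => ((k : ℝ) - 1) / √V) ^ 2) k ∂P = 1 := by
    rw [hP, integral_sum_dirac htop]
    have := hvar.div_const V
    rw [div_self hV.ne'] at this
    refine Eq.trans (tsum_congr fun k => ?_) this.tsum_eq
    rw [ENNReal.toReal_ofReal (hr k), smul_eq_mul, Pi.pow_apply, div_pow, Real.sq_sqrt hV.le]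
    ring
  have key := ProbabilityTheory.tendsto_charFun_inv_sqrt_mul_pow hmX.aemeasurable hm0 hm1
    (√V * s)
  convert key using 2 with n
  · rw [charFun_apply_real, integral_map hmX.aemeasurable (by fun_prop), hP,
      integral_sum_dirac htop, charSeries, ← tsum_mul_right]
    congr 2 with k
    rw [ENNReal.toReal_ofReal (hr k), Complex.real_smul, mul_assoc, ← Complex.exp_add]
    congr 2
    have hsq' : ((√V : ℝ) : ℂ) ≠ 0 := by exact_mod_cast hsq
    push_cast
    field_simp
    ring
  · rw [← Complex.ofReal_pow (√V * s), mul_pow, Real.sq_sqrt hV.le]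
    push_cast
    ring_nf

lemma exists_forall_le_of_eventually {u : ℕ → ℝ} (hu : ∀ n, 0 ≤ u n) {c : ℝ} (hc : 0 < c)
    (h : ∀ᶠ n in atTop, u n ≠ 0 → c ≤ u n) : ∃ c' : ℝ, 0 < c' ∧ ∀ n, u n ≠ 0 → c' ≤ u n := by
  obtain ⟨N, hN⟩ := eventually_atTop.1 h
  clear h
  induction N generalizing c with
  | zero => exact ⟨c, hc, fun n => hN n n.zero_le⟩
  | succ N ih =>
    by_cases h0 : u N = 0
    · refine ih hc fun n hn hne => hN n ?_ hne
      rcases hn.eq_or_lt with rfl | hlt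
      · exact absurd h0 hne
      · exact hlt
    · have hpos : 0 < u N := lt_of_le_of_ne (hu N) (Ne.symm h0)
      refine ih (lt_min hc hpos) fun n hn hne => ?_
      rcases hn.eq_or_lt with rfl | hlt
      · exact min_le_right _ _
      · exact (min_le_left _ _).trans (hN n hlt hne)

/-- Local limit theorem at the mean, as a lower bound for the coefficients that do not vanish. -/
lemma exists_le_coeff_mk_pow (hr : ∀ k, 0 ≤ r k) (hs : HasSum r 1)
    (hmean : HasSum (fun k : ℕ => (k : ℝ) * r k) 1) {V : ℝ} (hV : 0 < V)
    (hvar : HasSum (fun k : ℕ => r k * ((k : ℝ) - 1) ^ 2) V) {h : ℕ} (hh0 : h ≠ 0)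
    (hh : ∀ k, r k ≠ 0 → h ∣ k) {a : ℝ} (ha : 0 < a)
    (hexp : ∀ t : ℝ, |t| ≤ Real.pi / h → ‖charSeries r t‖ ≤ Real.exp (-a * t ^ 2)) :
    ∃ c : ℝ, 0 < c ∧ ∀ n : ℕ, coeff n (PowerSeries.mk r ^ (n + 1)) ≠ 0 →
      c / √(n + 1 : ℕ) ≤ coeff n (PowerSeries.mk r ^ (n + 1)) := by
  have hπ := Real.pi_pos
  have hhpos : (0 : ℝ) < h := by positivity
  have hδ : 0 < Real.pi / h := by positivity
  have hab : -(Real.pi / h) ≤ Real.pi / h := by linarith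
  have hcont := continuous_charSeries hr hs.summable
  set f : ℕ → ℝ → ℂ := fun n t =>
    charSeries r t ^ (n + 1) * Complex.exp (-(n * t * Complex.I)) with hf
  set G : ℕ → ℝ → ℂ := fun n => (Ioc (-(Real.pi / h)) (Real.pi / h)).indicator (f n) with hG
  have hfc : ∀ n, Continuous (f n) := fun n => by fun_prop
  have hlim : Tendsto (fun n : ℕ => ∫ s : ℝ, G n (s / √(n + 1 : ℕ))) atTop
      (nhds (∫ s : ℝ, Complex.exp (-(V * s ^ 2) / 2))) := by
    refine tendsto_integral_of_dominated_convergence (fun s => Real.exp (-a * s ^ 2))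
      (fun n => ?_) (integrable_exp_neg_mul_sq ha) (fun n => Eventually.of_forall fun s => ?_)
      (Eventually.of_forall fun s => ?_)
    · have : Measurable (G n) := (hfc n).measurable.indicator measurableSet_Ioc
      exact (this.comp (measurable_id.div_const _)).aestronglyMeasurable
    · by_cases hmem : s / √(n + 1 : ℕ) ∈ Ioc (-(Real.pi / h)) (Real.pi / h)
      · rw [hG]
        simp only [indicator_of_mem hmem, hf]
        rw [norm_mul, norm_pow, Complex.exp_neg, norm_inv, norm_exp_natCast_mul, inv_one, mul_one]
        calc _ ≤ Real.exp (-a * (s / √(n + 1 : ℕ)) ^ 2) ^ (n + 1) := by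
              gcongr
              exact hexp _ (abs_le.2 ⟨hmem.1.le, hmem.2⟩)
          _ = _ := by
              rw [← Real.exp_nat_mul, div_pow, Real.sq_sqrt (by positivity)]
              congr 1
              field_simp
      · rw [hG]
        simp only [indicator_of_notMem hmem, norm_zero]
        exact (Real.exp_pos _).le
    · have hu : Tendsto (fun n : ℕ => s / √(n + 1 : ℕ)) atTop (nhds 0) :=
        ((Tendsto.const_div_atTop
          (Real.tendsto_sqrt_atTop.comp tendsto_natCast_atTop_atTop) s).comp
          (tendsto_add_atTop_nat 1))
      have h1 := (tendsto_charSeries_pow hr hs hmean hV hvar s).comp (tendsto_add_atTop_nat 1)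
      have h2 : Tendsto (fun n : ℕ => Complex.exp ((s / √(n + 1 : ℕ) : ℝ) * Complex.I)) atTop
          (nhds 1) := by
        have hc : Continuous fun x : ℝ => Complex.exp (x * Complex.I) := by fun_prop
        simpa [Function.comp_def] using (hc.tendsto 0).comp hu
      have h3 := h1.mul h2
      rw [mul_one] at h3
      refine h3.congr' ?_
      filter_upwards [hu.eventually (Ioo_mem_nhds (neg_lt_zero.2 hδ) hδ)] with n hn
      rw [hG]
      simp only [indicator_of_mem (Ioo_subset_Ioc_self hn), hf, Function.comp_apply]
      rw [mul_pow, mul_assoc, ← Complex.exp_nat_mul, ← Complex.exp_add]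
      congr 2
      push_cast
      ring
  have hgauss : ∫ s : ℝ, Complex.exp (-(V * s ^ 2) / 2) = ((√(Real.pi / (V / 2)) : ℝ) : ℂ) := by
    rw [← integral_gaussian, ← integral_complex_ofReal]
    congr 1 with s
    push_cast
    ring_nf
  rw [hgauss] at hlim
  have hre := (Complex.continuous_re.tendsto _).comp hlim
  rw [Complex.ofReal_re] at hre
  set L := √(Real.pi / (V / 2)) with hL
  have hLpos : 0 < L := by positivity
  have hval : ∀ n : ℕ, coeff n (PowerSeries.mk r ^ (n + 1)) ≠ 0 →
      (∫ s : ℝ, G n (s / √(n + 1 : ℕ))).re =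
        √(n + 1 : ℕ) * coeff n (PowerSeries.mk r ^ (n + 1)) * (2 * Real.pi / h) := by
    intro n hn
    rw [Measure.integral_comp_div, hG, integral_indicator measurableSet_Ioc,
      ← intervalIntegral.integral_of_le hab, coeff_mk_pow_eq_integral hr hs.summable hh0 hh _
        (dvd_of_coeff_mk_pow_ne_zero hh hn), Complex.smul_re, Complex.ofReal_re,
      abs_of_nonneg (Real.sqrt_nonneg _), smul_eq_mul]
    ring
  obtain ⟨c, hc, hcn⟩ := exists_forall_le_of_eventually
    (u := fun n => √(n + 1 : ℕ) * coeff n (PowerSeries.mk r ^ (n + 1)))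
    (c := L / 2 / (2 * Real.pi / h))
    (fun n => mul_nonneg (Real.sqrt_nonneg _) (coeff_mk_pow_nonneg hr _ _)) (by positivity) (by
      filter_upwards [hre.eventually (lt_mem_nhds (half_lt_self hLpos))] with n hn hne
      rw [Function.comp_apply, hval n (right_ne_zero_of_mul hne)] at hn
      rw [div_le_iff₀ (by positivity)]
      exact hn.le)
  refine ⟨c, hc, fun n hn => ?_⟩
  have hpos : 0 < √(n + 1 : ℕ) := Real.sqrt_pos.2 (by positivity)
  rw [div_le_iff₀ hpos, mul_comm]
  have hne : √(n + 1 : ℕ) ≠ 0 := ne_of_gt hpos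
  exact hcn n (mul_ne_zero hne hn)

/-- Two-sided local estimate for a critical offspring distribution with finite variance. -/
lemma exists_coeff_mk_pow_bounds (hr : ∀ k, 0 ≤ r k) (hs : HasSum r 1)
    (hmean : HasSum (fun k : ℕ => (k : ℝ) * r k) 1) {V : ℝ} (hV : 0 < V)
    (hvar : HasSum (fun k : ℕ => r k * ((k : ℝ) - 1) ^ 2) V) :
    (∃ C : ℝ, 0 < C ∧ ∀ m : ℕ, 1 ≤ m → ∀ j, coeff j (PowerSeries.mk r ^ m) ≤ C / √m) ∧
    ∃ c : ℝ, 0 < c ∧ ∀ n : ℕ, coeff n (PowerSeries.mk r ^ (n + 1)) ≠ 0 →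
      c / √(n + 1 : ℕ) ≤ coeff n (PowerSeries.mk r ^ (n + 1)) := by
  have hr0 : r 0 ≠ 0 := by
    intro h0
    have hterm : ∀ k : ℕ, 0 ≤ (k : ℝ) * r k - r k := by
      intro k
      rcases k.eq_zero_or_pos with rfl | hk
      · simp [h0]
      · have : (1 : ℝ) ≤ k := by exact_mod_cast hk
        nlinarith [hr k]
    have hz := hmean.sub hs
    rw [sub_self, hasSum_zero_iff_of_nonneg hterm] at hz
    have hz' : ∀ k : ℕ, r k * ((k : ℝ) - 1) ^ 2 = 0 := by
      intro k
      have := congrFun hz k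
      simp only [Pi.zero_apply] at this
      linear_combination ((k : ℝ) - 1) * this
    rw [funext hz'] at hvar
    exact hV.ne (hasSum_zero.unique hvar)
  obtain ⟨k₀, hk₀⟩ : ∃ k : ℕ, (k : ℝ) * r k ≠ 0 := by
    by_contra! hall
    rw [funext hall] at hmean
    exact one_ne_zero (hmean.unique hasSum_zero)
  have hk : k₀ ≠ 0 := by
    rintro rfl
    simp at hk₀
  have hrk := right_ne_zero_of_mul hk₀
  obtain ⟨h, hh0, hh, hspan⟩ := exists_span hk hrk
  obtain ⟨a, ha, hexp⟩ := exists_norm_charSeries_le_exp hr hs hr0 hk hrk hh0 hspan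
  exact ⟨exists_coeff_mk_pow_le hr hs hh0 hh ha hexp,
    exists_le_coeff_mk_pow hr hs hmean hV hvar hh0 hh ha hexp⟩

end LocalLimit

lemma coeff_mk_pow_eq_ofReal {p : ℕ → ℝ≥0∞} (hp : ∀ k, p k ≠ ⊤) (m j : ℕ) :
    coeff j (PowerSeries.mk p ^ m) =
      ENNReal.ofReal (coeff j (PowerSeries.mk (fun k => (p k).toReal) ^ m)) := by
  induction m generalizing j with
  | zero =>
    rw [pow_zero, pow_zero, coeff_one, coeff_one]
    split_ifs <;> simp
  | succ m ih =>
    have hnn := coeff_mk_pow_nonneg (r := fun k => (p k).toReal) fun k => ENNReal.toReal_nonneg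
    rw [pow_succ, pow_succ, coeff_mul, coeff_mul, ENNReal.ofReal_sum_of_nonneg
      fun x _ => mul_nonneg (hnn m _) (by rw [coeff_mk]; exact ENNReal.toReal_nonneg)]
    refine Finset.sum_congr rfl fun x _ => ?_
    rw [ih, ENNReal.ofReal_mul (hnn m _), coeff_mk, coeff_mk, ENNReal.ofReal_toReal (hp _)]

lemma tsum_factorial_moment_le (p : ℕ → ℝ≥0∞) :
    ∑' d : ℕ, ((d * (d - 1) : ℕ) : ℝ≥0∞) * p d ≤ 2 * xiVar p := by
  rw [xiVar, ← ENNReal.tsum_mul_left]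
  refine ENNReal.tsum_le_tsum fun d => ?_
  rw [mul_left_comm, mul_comm]
  gcongr
  rw [← ENNReal.ofReal_natCast, ← ENNReal.ofReal_ofNat, ← ENNReal.ofReal_mul (by norm_num)]
  refine ENNReal.ofReal_le_ofReal ?_
  rcases d with _ | _ | d
  · simp
  · simp
  · push_cast
    nlinarith [(Nat.cast_nonneg d : (0 : ℝ) ≤ d)]

lemma exists_ennreal_coeff_bounds {p : ℕ → ℝ≥0∞} (hp : ∑' k : ℕ, p k = 1)
    (hmean : ∑' k : ℕ, (k : ℝ≥0∞) * p k = 1)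
    (hvar_pos : 0 < xiVar p) (hvar_fin : xiVar p ≠ ⊤) :
    (∃ C : ℝ, 0 < C ∧ ∀ m : ℕ, 1 ≤ m → ∀ j,
      coeff j (PowerSeries.mk p ^ m) ≤ ENNReal.ofReal (C / √m)) ∧
    ∃ c : ℝ, 0 < c ∧ ∀ n : ℕ, 1 ≤ n → coeff (n - 1) (PowerSeries.mk p ^ n) ≠ 0 →
      ENNReal.ofReal (c / √n) ≤ coeff (n - 1) (PowerSeries.mk p ^ n) := by
  have hfin : ∀ k, p k ≠ ⊤ := ENNReal.ne_top_of_tsum_ne_top (hp ▸ ENNReal.one_ne_top)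
  have hasSum_of_tsum : ∀ f : ℕ → ℝ≥0∞, ∑' k, f k ≠ ⊤ →
      HasSum (fun k => (f k).toReal) (∑' k, f k).toReal := fun f hf => by
    rw [ENNReal.tsum_toReal_eq (ENNReal.ne_top_of_tsum_ne_top hf)]
    exact ENNReal.hasSum_toReal hf
  have hs := hasSum_of_tsum p (hp ▸ ENNReal.one_ne_top)
  have hm := hasSum_of_tsum (fun k => k * p k) (hmean ▸ ENNReal.one_ne_top)
  have hv := hasSum_of_tsum (fun k => p k * ENNReal.ofReal (((k : ℝ) - 1) ^ 2)) hvar_fin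
  simp only [hp, hmean, ENNReal.toReal_one, ENNReal.toReal_mul, ENNReal.toReal_natCast,
    ENNReal.toReal_ofReal (sq_nonneg _)] at hs hm hv
  obtain ⟨⟨C, hC, hupper⟩, c, hc, hlower⟩ := exists_coeff_mk_pow_bounds
    (fun k => ENNReal.toReal_nonneg) hs hm (ENNReal.toReal_pos hvar_pos.ne' hvar_fin) hv
  refine ⟨⟨C, hC, fun m hm j => ?_⟩, c, hc, fun n hn hne => ?_⟩
  · rw [coeff_mk_pow_eq_ofReal hfin]
    exact ENNReal.ofReal_le_ofReal (hupper m hm j)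
  · obtain ⟨n, rfl⟩ := Nat.exists_eq_add_of_le' hn
    rw [coeff_mk_pow_eq_ofReal hfin] at hne ⊢
    exact ENNReal.ofReal_le_ofReal (hlower n fun h0 => hne (by simp [h0]))

/-- Theorem 1 of Devroye–Janson.  For a critical offspring
distribution with finite positive variance, there is a constant `C > 0` such that
`E P_k(T_n) ≤ C n k` for all `k, n ≥ 1` for which `T_n` is defined. -/
theorem expected_pairCount_le
    (p : ℕ → ℝ≥0∞) (hp : ∑' k : ℕ, p k = 1)
    (hmean : ∑' k : ℕ, (k : ℝ≥0∞) * p k = 1)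
    (hvar_pos : 0 < xiVar p) (hvar_fin : xiVar p ≠ ⊤) :
    ∃ C : ℝ, 0 < C ∧ ∀ k n : ℕ, 1 ≤ k → 1 ≤ n → probSize p n ≠ 0 →
      condExp p n (fun t => (pairCount t k : ℝ≥0∞)) ≤ ENNReal.ofReal (C * n * k) := by
  obtain ⟨⟨A, hA, hupper⟩, c, hc, hlower⟩ :=
    exists_ennreal_coeff_bounds hp hmean hvar_pos hvar_fin
  set v : ℝ≥0∞ := ∑' d : ℕ, ((d * (d - 1) : ℕ) : ℝ≥0∞) * p d with hv
  have hvfin : v ≠ ⊤ := ne_top_of_le_ne_top (ENNReal.mul_ne_top (by simp) hvar_fin)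
    (tsum_factorial_moment_le p)
  have hv0 : 0 ≤ v.toReal := ENNReal.toReal_nonneg
  refine ⟨2 + (2 + v.toReal) * (A * 2) / c, by positivity, fun k n hk hn hprob => ?_⟩
  have hn0 : (0 : ℝ) < n := by exact_mod_cast hn
  have hk1 : (1 : ℝ) ≤ k := by exact_mod_cast hk
  refine ENNReal.div_le_of_le_mul ?_
  have hnum : (∑' t : PlaneTree, if PlaneTree.size t = n then
      gwProb p t * (pairCount t k : ℝ≥0∞) else 0) ≤ coeff n (treeGF p (orderedPairs k)) := by
    rw [treeGF, coeff_weightGF]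
    refine ENNReal.tsum_le_tsum fun t => ?_
    split_ifs
    · gcongr
      exact pairCount_le_orderedPairs k t
    · rfl
  rcases lt_or_ge n (2 * k) with hlt | hge
  · calc _ ≤ ∑' t : PlaneTree, (n : ℝ≥0∞) ^ 2 *
            (if PlaneTree.size t = n then gwProb p t else 0) := by
          refine ENNReal.tsum_le_tsum fun t => ?_
          split_ifs with hsize
          · rw [mul_comm, ← hsize]
            gcongr
            exact (pairCount_le_orderedPairs k t).trans (orderedPairs_le k t)
          · simp
      _ = (n : ℝ≥0∞) ^ 2 * probSize p n := by rw [ENNReal.tsum_mul_left, probSize]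
      _ ≤ _ := by
          gcongr
          rw [← ENNReal.ofReal_natCast, ← ENNReal.ofReal_pow hn0.le]
          refine ENNReal.ofReal_le_ofReal ?_
          have hlt' : (n : ℝ) ≤ 2 * k := by exact_mod_cast hlt.le
          have : 0 ≤ (2 + v.toReal) * (A * 2) / c * n * k := by positivity
          nlinarith
  · have hsub : 1 ≤ n - k := by omega
    have hcoeff : coeff (n - 1) (PowerSeries.mk p ^ n) ≠ 0 := by
      rw [← natCast_mul_probSize p hn]
      exact mul_ne_zero (by exact_mod_cast (by omega : n ≠ 0)) hprob
    have hsqrt : √n / 2 ≤ √(n - k : ℕ) := by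
      refine Real.le_sqrt_of_sq_le ?_
      rw [div_pow, Real.sq_sqrt hn0.le, Nat.cast_sub (by omega)]
      have : (2 * k : ℝ) ≤ n := by exact_mod_cast hge
      linarith
    have hb : ∀ M, n - k ≤ M → ∀ j,
        coeff j (PowerSeries.mk p ^ M) ≤ ENNReal.ofReal (A * 2 / √n) := by
      intro M hM j
      refine (hupper M (hsub.trans hM) j).trans (ENNReal.ofReal_le_ofReal ?_)
      have hle : √n / 2 ≤ √M := hsqrt.trans (Real.sqrt_le_sqrt (by exact_mod_cast hM))
      calc A / √M ≤ A / (√n / 2) := by gcongr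
        _ = _ := by field_simp
    calc _ ≤ (2 + k * v) * ENNReal.ofReal (A * 2 / √n) :=
          hnum.trans (coeff_treeGF_orderedPairs_le hmean hk (by omega) hb)
      _ = ENNReal.ofReal ((2 + k * v.toReal) * (A * 2 / √n)) := by
          rw [ENNReal.ofReal_mul (by positivity), ENNReal.ofReal_add (by norm_num) (by positivity),
            ENNReal.ofReal_mul (by positivity), ENNReal.ofReal_toReal hvfin,
            ENNReal.ofReal_natCast, ENNReal.ofReal_ofNat]
      _ ≤ ENNReal.ofReal ((2 + (2 + v.toReal) * (A * 2) / c) * k * (c / √n)) := by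
          refine ENNReal.ofReal_le_ofReal ?_
          calc _ ≤ (2 * k + k * v.toReal) * (A * 2 / √n) := by gcongr; linarith
            _ = (2 + v.toReal) * (A * 2) / c * k * (c / √n) := by field_simp
            _ ≤ _ := by gcongr; linarith
      _ ≤ ENNReal.ofReal ((2 + (2 + v.toReal) * (A * 2) / c) * k) *
          (n * probSize p n) := by
          rw [ENNReal.ofReal_mul (by positivity), natCast_mul_probSize p hn]
          gcongr
          exact hlower n hn hcoeff
      _ = _ := by
          rw [← mul_assoc, ← ENNReal.ofReal_natCast n, ← ENNReal.ofReal_mul (by positivity),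
            mul_right_comm]
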